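/- Let p > 1, γ, λ, μ ∈ ℝ, and let û₀ : ℝ² → ℂ be measurable with 0 < ‖û₀‖_p = R < ∞. There exists T > 0 with the following property. Define, for continuous curves v : [0,T] → X_p, (Av)(t)(k,m) = û₀(k,m) e^{i(m² − k²)t} − i ∫₀ᵗ e^{i(k² − m²)(τ − t)} L(v(τ)·e_{2τ})(k,m) dτ, where e_{2τ}(k,m) = e^{2i(k² − m²)τ}. Then A maps the closed ball B = {v ∈ C([0,T]; X_p) : sup_{t ∈ [0,T]} ‖v(t)‖_p ≤ 2R} into itself, and for all v, w ∈ B, sup_{t ∈ [0,T]} ‖(Av)(t) − (Aw)(t)‖_p ≤ (1/2)·sup_{t ∈ [0,T]} ‖v(t) − w(t)‖_p. -/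

import Mathlib

open MeasureTheory Filter
open scoped ENNReal Topology

/-- The weighted norm `‖v‖_p = (∫ (1 + |k| + |m|)^(2p) |v(k,m)|² dk dm)^(1/2)` on `ℝ²`. -/
noncomputable def wnorm (p : ℝ) (v : ℝ × ℝ → ℂ) : ℝ≥0∞ :=
  (∫⁻ km : ℝ × ℝ, ENNReal.ofReal ((1 + |km.1| + |km.2|) ^ (2 * p)) * (‖v km‖₊ : ℝ≥0∞) ^ 2) ^
    ((1 : ℝ) / 2)

/-- The convolution `(f ⋆ g)(ξ) = ∫ f (ξ - η) g η dη` over `ℝ²`. -/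
noncomputable def conv (f g : ℝ × ℝ → ℂ) : ℝ × ℝ → ℂ :=
  fun ξ => ∫ η : ℝ × ℝ, f (ξ - η) * g η

/-- `v†(k,m) = conj (v (-k, -m))`, the Fourier transform of the complex conjugate. -/
def dag (v : ℝ × ℝ → ℂ) : ℝ × ℝ → ℂ :=
  fun km => starRingEnd ℂ (v (-km))

/-- `σ(k,m) = k² / (k² + m²)` for `(k,m) ≠ 0`, and `σ(0,0) = 0`. -/
noncomputable def sigmaMul : ℝ × ℝ → ℝ :=
  fun km => if km = 0 then 0 else km.1 ^ 2 / (km.1 ^ 2 + km.2 ^ 2)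

/-- The Fourier-side Davey–Stewartson-II nonlinearity
`L(v) = γ (v ⋆ v† ⋆ v) + λμ (v ⋆ (σ · (v ⋆ v†)))`. -/
noncomputable def Lop (γ lam μ : ℝ) (v : ℝ × ℝ → ℂ) : ℝ × ℝ → ℂ :=
  fun km => (γ : ℂ) * conv (conv v (dag v)) v km +
    ((lam * μ : ℝ) : ℂ) * conv v (fun η => (sigmaMul η : ℂ) * conv v (dag v) η) km

/-- `e_{2τ}(k,m) = e^{2i(k² - m²)τ}`. -/
noncomputable def phase2 (τ : ℝ) (km : ℝ × ℝ) : ℂ :=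
  Complex.exp (2 * Complex.I * (((km.1 ^ 2 - km.2 ^ 2) * τ : ℝ) : ℂ))

/-- The Duhamel (mild-solution) integral operator
`(Av)(t)(k,m) = û₀(k,m) e^{i(m² - k²)t}
  - i ∫₀ᵗ e^{i(k² - m²)(τ - t)} L(v(τ)·e_{2τ})(k,m) dτ`. -/
noncomputable def duhamel (γ lam μ : ℝ) (u0 : ℝ × ℝ → ℂ) (v : ℝ → ℝ × ℝ → ℂ) (t : ℝ) :
    ℝ × ℝ → ℂ :=
  fun km => u0 km * Complex.exp (Complex.I * (((km.2 ^ 2 - km.1 ^ 2) * t : ℝ) : ℂ)) -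
    Complex.I * ∫ τ in (0:ℝ)..t,
      Complex.exp (Complex.I * (((km.1 ^ 2 - km.2 ^ 2) * (τ - t) : ℝ) : ℂ)) *
        Lop γ lam μ (fun km' => v τ km' * phase2 τ km') km

/-- A curve `v : [0,T] → X_p`: measurable values, continuous with respect to `‖·‖_p`. -/
def ContCurve (p T : ℝ) (v : ℝ → ℝ × ℝ → ℂ) : Prop :=
  (∀ t ∈ Set.Icc (0 : ℝ) T, Measurable (v t)) ∧
  ∀ t₀ ∈ Set.Icc (0 : ℝ) T,
    Tendsto (fun t => wnorm p (v t - v t₀)) (𝓝[Set.Icc (0 : ℝ) T] t₀) (𝓝 0)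

/-! ### Squared integral inequalities -/

lemma lintegral_mul_sq_le_mul {α : Type*} [MeasurableSpace α] {ν : Measure α} {f g : α → ℝ≥0∞}
    (hf : AEMeasurable f ν) (hg : AEMeasurable g ν) :
    (∫⁻ x, f x * g x ∂ν) ^ 2 ≤ (∫⁻ x, f x ^ 2 ∂ν) * ∫⁻ x, g x ^ 2 ∂ν := by
  have h := ENNReal.lintegral_mul_le_Lp_mul_Lq ν Real.HolderConjugate.two_two hf hg
  simp only [Pi.mul_apply, ENNReal.rpow_two] at h
  calc _ ≤ _ := pow_le_pow_left' h 2
    _ = _ := by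
      rw [mul_pow, ← ENNReal.rpow_two, ← ENNReal.rpow_two, ← ENNReal.rpow_mul,
        ← ENNReal.rpow_mul]
      norm_num

lemma lintegral_mul_sq_le_lintegral_mul {α : Type*} [MeasurableSpace α] {ν : Measure α}
    {f g : α → ℝ≥0∞} (hf : AEMeasurable f ν) (hg : AEMeasurable g ν) :
    (∫⁻ x, f x * g x ∂ν) ^ 2 ≤ (∫⁻ x, f x ∂ν) * ∫⁻ x, f x * g x ^ 2 ∂ν := by
  have hs : ∀ a : ℝ≥0∞, (a ^ (1 / 2 : ℝ)) ^ 2 = a := fun a => by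
    rw [← ENNReal.rpow_two, ← ENNReal.rpow_mul]; norm_num
  have h := lintegral_mul_sq_le_mul (hf.pow_const (1 / 2 : ℝ))
    ((hf.pow_const (1 / 2 : ℝ)).mul hg)
  simp only [Pi.mul_apply, mul_pow, hs] at h
  refine le_trans (le_of_eq ?_) h
  congr 2
  ext x
  rw [← mul_assoc, ← sq, hs]

/-! ### Convolution of nonnegative functions -/

/-- The convolution over `ℝ²` of functions with values in `[0, ∞]`. -/
noncomputable def lconv (F G : ℝ × ℝ → ℝ≥0∞) : ℝ × ℝ → ℝ≥0∞ :=
  fun ξ => ∫⁻ η : ℝ × ℝ, F (ξ - η) * G η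

lemma lconv_comm (F G : ℝ × ℝ → ℝ≥0∞) : lconv F G = lconv G F := by
  ext ξ
  unfold lconv
  rw [← lintegral_sub_left_eq_self _ ξ]
  simp [mul_comm]

lemma measurable_lconv {F G : ℝ × ℝ → ℝ≥0∞} (hF : Measurable F) (hG : Measurable G) :
    Measurable (lconv F G) :=
  Measurable.lintegral_prod_right' (f := fun z : (ℝ × ℝ) × (ℝ × ℝ) => F (z.1 - z.2) * G z.2)
    (by fun_prop)

lemma lconv_sq_le {F G : ℝ × ℝ → ℝ≥0∞} (hF : Measurable F) (hG : Measurable G) (ξ : ℝ × ℝ) :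
    lconv F G ξ ^ 2 ≤ (∫⁻ x, F x ^ 2) * ∫⁻ x, G x ^ 2 := by
  refine (lintegral_mul_sq_le_mul (by fun_prop) (by fun_prop)).trans_eq ?_
  rw [lintegral_sub_left_eq_self (fun η => F η ^ 2) ξ]

lemma lintegral_lconv_sq_le {F G : ℝ × ℝ → ℝ≥0∞} (hF : Measurable F) (hG : Measurable G) :
    ∫⁻ ξ, lconv F G ξ ^ 2 ≤ (∫⁻ x, F x) ^ 2 * ∫⁻ x, G x ^ 2 := by
  calc ∫⁻ ξ, lconv F G ξ ^ 2
      ≤ ∫⁻ ξ, (∫⁻ x, F x) * ∫⁻ η : ℝ × ℝ, F (ξ - η) * G η ^ 2 := by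
        refine lintegral_mono fun ξ => ?_
        refine (lintegral_mul_sq_le_lintegral_mul (by fun_prop) (by fun_prop)).trans_eq ?_
        rw [lintegral_sub_left_eq_self (fun η => F η) ξ]
    _ = (∫⁻ x, F x) * ∫⁻ ξ, ∫⁻ η : ℝ × ℝ, F (ξ - η) * G η ^ 2 := by
        refine lintegral_const_mul _ (Measurable.lintegral_prod_right'
          (f := fun z : (ℝ × ℝ) × (ℝ × ℝ) => F (z.1 - z.2) * G z.2 ^ 2) (by fun_prop))
    _ = (∫⁻ x, F x) * ∫⁻ η, ∫⁻ ξ : ℝ × ℝ, F (ξ - η) * G η ^ 2 := by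
        rw [lintegral_lintegral_swap]
        exact Measurable.aemeasurable (by unfold Function.uncurry; fun_prop)
    _ = _ := by
        have : ∀ η : ℝ × ℝ, ∫⁻ ξ : ℝ × ℝ, F (ξ - η) * G η ^ 2 = (∫⁻ x, F x) * G η ^ 2 := by
          intro η
          rw [lintegral_mul_const _ (by fun_prop), lintegral_sub_right_eq_self F η]
        simp_rw [this]
        rw [lintegral_const_mul _ (by fun_prop), sq, mul_assoc]

/-! ### The weight -/

/-- The weight `(1 + |k| + |m|)^p`, valued in `[0, ∞]`. -/
noncomputable def wt (p : ℝ) (x : ℝ × ℝ) : ℝ≥0∞ :=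
  ENNReal.ofReal ((1 + |x.1| + |x.2|) ^ p)

lemma measurable_wt (p : ℝ) : Measurable (wt p) := by
  unfold wt; fun_prop

lemma one_le_wt {p : ℝ} (hp : 0 ≤ p) (x : ℝ × ℝ) : 1 ≤ wt p x := by
  rw [wt, ENNReal.one_le_ofReal]
  exact Real.one_le_rpow (by linarith [abs_nonneg x.1, abs_nonneg x.2]) hp

lemma wt_sq (p : ℝ) (x : ℝ × ℝ) :
    wt p x ^ 2 = ENNReal.ofReal ((1 + |x.1| + |x.2|) ^ (2 * p)) := by
  have h : 0 ≤ 1 + |x.1| + |x.2| := by positivity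
  rw [wt, ← ENNReal.ofReal_pow (by positivity), mul_comm, Real.rpow_mul h, Real.rpow_two]

lemma wt_add_le {p : ℝ} (hp : 0 ≤ p) (x y : ℝ × ℝ) :
    wt p (x + y) ≤ ENNReal.ofReal (2 ^ p) * (wt p x + wt p y) := by
  unfold wt
  rw [← ENNReal.ofReal_add (by positivity) (by positivity),
    ← ENNReal.ofReal_mul (by positivity)]
  refine ENNReal.ofReal_le_ofReal ?_
  set a := 1 + |x.1| + |x.2| with ha
  set b := 1 + |y.1| + |y.2| with hb
  have ha0 : 0 ≤ a := by positivity
  have hb0 : 0 ≤ b := by positivity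
  have h1 : 1 + |(x + y).1| + |(x + y).2| ≤ 2 * max a b := by
    have := abs_add_le x.1 y.1
    have := abs_add_le x.2 y.2
    have := le_max_left a b
    have := le_max_right a b
    simp only [Prod.fst_add, Prod.snd_add]
    linarith
  calc (1 + |(x + y).1| + |(x + y).2|) ^ p ≤ (2 * max a b) ^ p :=
        Real.rpow_le_rpow (by positivity) h1 hp
    _ = 2 ^ p * max a b ^ p := Real.mul_rpow (by norm_num) (by positivity)
    _ ≤ 2 ^ p * (a ^ p + b ^ p) := by
        gcongr
        have := Real.rpow_nonneg ha0 p
        have := Real.rpow_nonneg hb0 p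
        rcases max_choice a b with h | h <;> rw [h] <;> linarith

/-- The squared `L²` norm of the inverse weight. -/
noncomputable def invWtMass (p : ℝ) : ℝ≥0∞ := ∫⁻ x, ((wt p x)⁻¹) ^ 2

lemma invWtMass_lt_top {p : ℝ} (hp : 1 < p) : invWtMass p < ⊤ := by
  have h := finite_integral_one_add_norm (E := ℝ × ℝ) (μ := volume) (r := 2 * p)
    (by simp; linarith)
  refine lt_of_le_of_lt (lintegral_mono fun x => ?_) h
  rw [← ENNReal.inv_pow, wt_sq, ← ENNReal.ofReal_inv_of_pos (by positivity),
    ← Real.rpow_neg (by positivity)]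
  refine ENNReal.ofReal_le_ofReal (Real.rpow_le_rpow_of_nonpos (by positivity) ?_ (by linarith))
  have : ‖x‖ ≤ |x.1| + |x.2| := by
    rw [Prod.norm_def]
    exact max_le (by simp) (by simp)
  linarith

/-- The squared weighted `L²` norm of a nonnegative function. -/
noncomputable def wmass (p : ℝ) (F : ℝ × ℝ → ℝ≥0∞) : ℝ≥0∞ := ∫⁻ x, (wt p x * F x) ^ 2

lemma wmass_mono {p : ℝ} {F G : ℝ × ℝ → ℝ≥0∞} (h : ∀ x, F x ≤ G x) : wmass p F ≤ wmass p G :=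
  lintegral_mono fun x => by have := h x; gcongr

lemma lintegral_sq_le_wmass {p : ℝ} (hp : 0 ≤ p) (F : ℝ × ℝ → ℝ≥0∞) :
    ∫⁻ x, F x ^ 2 ≤ wmass p F :=
  lintegral_mono fun x => pow_le_pow_left' (le_mul_of_one_le_left' (one_le_wt hp x)) 2

lemma sq_lintegral_le_wmass {p : ℝ} (hp : 0 ≤ p) {F : ℝ × ℝ → ℝ≥0∞} (hF : Measurable F) :
    (∫⁻ x, F x) ^ 2 ≤ invWtMass p * wmass p F := by
  have hw := measurable_wt p
  refine le_trans (le_of_eq ?_) (lintegral_mul_sq_le_mul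
    (f := fun x => (wt p x)⁻¹) (g := fun x => wt p x * F x) (by fun_prop) (by fun_prop))
  congr 2
  ext x
  rw [← mul_assoc, ENNReal.inv_mul_cancel, one_mul]
  · exact (lt_of_lt_of_le one_pos (one_le_wt hp x)).ne'
  · exact ENNReal.ofReal_ne_top

/-- The square of the algebra constant of `X_p` under convolution. -/
noncomputable def algConst (p : ℝ) : ℝ≥0∞ :=
  1 + 4 * ENNReal.ofReal (2 ^ p) ^ 2 * invWtMass p

lemma algConst_lt_top {p : ℝ} (hp : 1 < p) : algConst p < ⊤ := by
  have := invWtMass_lt_top hp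
  unfold algConst
  finiteness

lemma wt_mul_lconv_le {p : ℝ} (hp : 0 ≤ p) {F G : ℝ × ℝ → ℝ≥0∞} (hF : Measurable F)
    (hG : Measurable G) (ξ : ℝ × ℝ) :
    wt p ξ * lconv F G ξ ≤ ENNReal.ofReal (2 ^ p) *
      (lconv (fun x => wt p x * F x) G ξ + lconv F (fun x => wt p x * G x) ξ) := by
  have hw := measurable_wt p
  unfold lconv
  rw [← lintegral_add_left (by fun_prop), ← lintegral_const_mul _ (by fun_prop),
    ← lintegral_const_mul _ (by fun_prop)]
  refine lintegral_mono fun η => ?_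
  have h := wt_add_le hp (ξ - η) η
  rw [sub_add_cancel] at h
  calc wt p ξ * (F (ξ - η) * G η)
      ≤ (ENNReal.ofReal (2 ^ p) * (wt p (ξ - η) + wt p η)) * (F (ξ - η) * G η) := by gcongr
    _ = _ := by ring

lemma wmass_lconv_le {p : ℝ} (hp : 0 ≤ p) {F G : ℝ × ℝ → ℝ≥0∞} (hF : Measurable F)
    (hG : Measurable G) : wmass p (lconv F G) ≤ algConst p * (wmass p F * wmass p G) := by
  have hw := measurable_wt p
  have key : ∀ {F G : ℝ × ℝ → ℝ≥0∞}, Measurable F → Measurable G →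
      ∫⁻ ξ, lconv F (fun x => wt p x * G x) ξ ^ 2 ≤ invWtMass p * wmass p F * wmass p G := by
    intro F G hF hG
    refine (lintegral_lconv_sq_le hF (by fun_prop)).trans ?_
    exact mul_le_mul' (sq_lintegral_le_wmass hp hF) le_rfl
  have m1 : Measurable (lconv (fun x => wt p x * F x) G) := measurable_lconv (by fun_prop) hG
  have m2 : Measurable (lconv F (fun x => wt p x * G x)) := measurable_lconv hF (by fun_prop)
  have two : ∀ a b : ℝ≥0∞, (a + b) ^ 2 ≤ 2 * (a ^ 2 + b ^ 2) := fun a b => by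
    have h := ENNReal.rpow_add_le_mul_rpow_add_rpow a b (p := 2) one_le_two
    norm_num at h
    exact h
  calc wmass p (lconv F G)
      ≤ ∫⁻ ξ, ENNReal.ofReal (2 ^ p) ^ 2 * (2 * (lconv (fun x => wt p x * F x) G ξ ^ 2 +
          lconv F (fun x => wt p x * G x) ξ ^ 2)) := by
        refine lintegral_mono fun ξ => ?_
        refine (pow_le_pow_left' (wt_mul_lconv_le hp hF hG ξ) 2).trans ?_
        rw [mul_pow]
        gcongr
        exact two _ _
    _ = ENNReal.ofReal (2 ^ p) ^ 2 * (2 * ((∫⁻ ξ, lconv (fun x => wt p x * F x) G ξ ^ 2) +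
          ∫⁻ ξ, lconv F (fun x => wt p x * G x) ξ ^ 2)) := by
        rw [lintegral_const_mul _ (by fun_prop), lintegral_const_mul _ (by fun_prop),
          lintegral_add_left (by fun_prop)]
    _ ≤ ENNReal.ofReal (2 ^ p) ^ 2 * (2 * (invWtMass p * wmass p G * wmass p F +
          invWtMass p * wmass p F * wmass p G)) := by
        gcongr
        · rw [lconv_comm]; exact key hG hF
        · exact key hF hG
    _ = (4 * ENNReal.ofReal (2 ^ p) ^ 2 * invWtMass p) * (wmass p F * wmass p G) := by ring
    _ ≤ _ := by
        gcongr
        exact le_add_self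

/-! ### The weighted norm and convolution -/

lemma wnorm_eq_wmass (p : ℝ) (v : ℝ × ℝ → ℂ) :
    wnorm p v = wmass p (fun x => ‖v x‖ₑ) ^ (1 / 2 : ℝ) := by
  simp only [wnorm, wmass, mul_pow, wt_sq]
  rfl

lemma wnorm_mono {p : ℝ} {f g : ℝ × ℝ → ℂ} (h : ∀ x, ‖f x‖ₑ ≤ ‖g x‖ₑ) :
    wnorm p f ≤ wnorm p g := by
  rw [wnorm_eq_wmass, wnorm_eq_wmass]
  exact ENNReal.rpow_le_rpow (wmass_mono h) (by norm_num)

lemma wnorm_congr {p : ℝ} {f g : ℝ × ℝ → ℂ} (h : ∀ x, ‖f x‖ₑ = ‖g x‖ₑ) :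
    wnorm p f = wnorm p g :=
  le_antisymm (wnorm_mono fun x => (h x).le) (wnorm_mono fun x => (h x).ge)

lemma wnorm_zero (p : ℝ) : wnorm p 0 = 0 := by
  simp [wnorm]

lemma wnorm_add_le {p : ℝ} {f g : ℝ × ℝ → ℂ} (hf : Measurable f) (hg : Measurable g) :
    wnorm p (f + g) ≤ wnorm p f + wnorm p g := by
  have hw := measurable_wt p
  simp only [wnorm_eq_wmass]
  have h := ENNReal.lintegral_Lp_add_le (μ := volume) (p := 2)
    (f := fun x => wt p x * ‖f x‖ₑ) (g := fun x => wt p x * ‖g x‖ₑ)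
    (by fun_prop) (by fun_prop) one_le_two
  simp only [Pi.add_apply, ENNReal.rpow_two, ← mul_add] at h
  refine le_trans (ENNReal.rpow_le_rpow (wmass_mono fun x => ?_) (by norm_num)) h
  exact enorm_add_le _ _

lemma wnorm_sub_le {p : ℝ} {f g : ℝ × ℝ → ℂ} (hf : Measurable f) (hg : Measurable g) :
    wnorm p (f - g) ≤ wnorm p f + wnorm p g := by
  rw [sub_eq_add_neg]
  refine (wnorm_add_le hf hg.neg).trans_eq ?_
  congr 1
  exact wnorm_congr fun x => by simp

lemma wnorm_const_mul (p : ℝ) (c : ℂ) (f : ℝ × ℝ → ℂ) :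
    wnorm p (fun x => c * f x) = ‖c‖ₑ * wnorm p f := by
  have h : wmass p (fun x => ‖c * f x‖ₑ) = ‖c‖ₑ ^ 2 * wmass p (fun x => ‖f x‖ₑ) := by
    unfold wmass
    rw [← lintegral_const_mul' _ _ (by finiteness)]
    congr 1; ext x
    simp only [enorm_mul]; ring
  rw [wnorm_eq_wmass, wnorm_eq_wmass, h, ENNReal.mul_rpow_of_nonneg _ _ (by norm_num),
    ← ENNReal.rpow_two, ← ENNReal.rpow_mul]
  norm_num

lemma wnorm_dag (p : ℝ) (v : ℝ × ℝ → ℂ) : wnorm p (dag v) = wnorm p v := by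
  simp only [wnorm_eq_wmass, wmass]
  congr 1
  rw [← lintegral_neg_eq_self]
  simp [dag, wt, ← ofReal_norm]

lemma measurable_dag {v : ℝ × ℝ → ℂ} (hv : Measurable v) : Measurable (dag v) :=
  Complex.continuous_conj.measurable.comp (hv.comp measurable_neg)

lemma dag_sub (v w : ℝ × ℝ → ℂ) : dag (v - w) = dag v - dag w := by
  ext x; simp [dag]

/-- The algebra constant of `X_p` under convolution. -/
noncomputable def convConst (p : ℝ) : ℝ≥0∞ := algConst p ^ (1 / 2 : ℝ)

lemma convConst_lt_top {p : ℝ} (hp : 1 < p) : convConst p < ⊤ :=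
  ENNReal.rpow_lt_top_of_nonneg (by norm_num) (algConst_lt_top hp).ne

lemma one_le_convConst (p : ℝ) : 1 ≤ convConst p :=
  ENNReal.one_le_rpow (by unfold algConst; exact le_self_add) (by norm_num)

lemma measurable_conv {f g : ℝ × ℝ → ℂ} (hf : Measurable f) (hg : Measurable g) :
    Measurable (conv f g) :=
  (StronglyMeasurable.integral_prod_right'
    (f := fun z : (ℝ × ℝ) × (ℝ × ℝ) => f (z.1 - z.2) * g z.2)
    (Measurable.stronglyMeasurable (by fun_prop))).measurable

lemma enorm_conv_le_lconv (f g : ℝ × ℝ → ℂ) (ξ : ℝ × ℝ) :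
    ‖conv f g ξ‖ₑ ≤ lconv (fun x => ‖f x‖ₑ) (fun x => ‖g x‖ₑ) ξ := by
  refine (enorm_integral_le_lintegral_enorm _).trans_eq ?_
  simp only [enorm_mul, lconv]

lemma wnorm_conv_le {p : ℝ} (hp : 0 ≤ p) {f g : ℝ × ℝ → ℂ} (hf : Measurable f)
    (hg : Measurable g) : wnorm p (conv f g) ≤ convConst p * (wnorm p f * wnorm p g) := by
  simp only [wnorm_eq_wmass, convConst]
  rw [← ENNReal.mul_rpow_of_nonneg _ _ (by norm_num),
    ← ENNReal.mul_rpow_of_nonneg _ _ (by norm_num)]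
  refine ENNReal.rpow_le_rpow ?_ (by norm_num)
  exact (wmass_mono (enorm_conv_le_lconv f g)).trans
    (wmass_lconv_le hp hf.enorm hg.enorm)

lemma lconv_enorm_le {p : ℝ} (hp : 0 ≤ p) {f g : ℝ × ℝ → ℂ} (hf : Measurable f)
    (hg : Measurable g) (ξ : ℝ × ℝ) :
    lconv (fun x => ‖f x‖ₑ) (fun x => ‖g x‖ₑ) ξ ≤ wnorm p f * wnorm p g := by
  simp only [wnorm_eq_wmass]
  rw [← ENNReal.mul_rpow_of_nonneg _ _ (by norm_num), one_div,
    ENNReal.le_rpow_inv_iff (by norm_num), ENNReal.rpow_two]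
  refine (lconv_sq_le hf.enorm hg.enorm ξ).trans ?_
  exact mul_le_mul' (lintegral_sq_le_wmass hp _) (lintegral_sq_le_wmass hp _)

lemma enorm_conv_le {p : ℝ} (hp : 0 ≤ p) {f g : ℝ × ℝ → ℂ} (hf : Measurable f)
    (hg : Measurable g) (ξ : ℝ × ℝ) :
    ‖conv f g ξ‖ₑ ≤ convConst p * (wnorm p f * wnorm p g) :=
  ((enorm_conv_le_lconv f g ξ).trans (lconv_enorm_le hp hf hg ξ)).trans
    (le_mul_of_one_le_left' (one_le_convConst p))

lemma integrable_conv {p : ℝ} (hp : 0 ≤ p) {f g : ℝ × ℝ → ℂ} (hf : Measurable f)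
    (hg : Measurable g) (hf' : wnorm p f < ⊤) (hg' : wnorm p g < ⊤) (ξ : ℝ × ℝ) :
    Integrable (fun η => f (ξ - η) * g η) := by
  refine ⟨(by fun_prop : Measurable _).aestronglyMeasurable, ?_⟩
  refine lt_of_le_of_lt ?_ (ENNReal.mul_lt_top hf' hg')
  refine le_trans (le_of_eq ?_) (lconv_enorm_le hp hf hg ξ)
  simp only [enorm_mul, lconv]

/-- An `X_p` function: measurable with finite weighted norm. -/
structure MemX (p : ℝ) (f : ℝ × ℝ → ℂ) : Prop where
  meas : Measurable f
  fin : wnorm p f < ⊤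

namespace MemX

variable {p : ℝ} {f g : ℝ × ℝ → ℂ}

lemma sub (hf : MemX p f) (hg : MemX p g) : MemX p (f - g) :=
  ⟨hf.meas.sub hg.meas, (wnorm_sub_le hf.meas hg.meas).trans_lt
    (ENNReal.add_lt_top.2 ⟨hf.fin, hg.fin⟩)⟩

lemma dag (hf : MemX p f) : MemX p (dag f) :=
  ⟨measurable_dag hf.meas, by rw [wnorm_dag]; exact hf.fin⟩

lemma conv (hp : 1 < p) (hf : MemX p f) (hg : MemX p g) : MemX p (conv f g) :=
  ⟨measurable_conv hf.meas hg.meas, (wnorm_conv_le (by linarith) hf.meas hg.meas).trans_lt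
    (ENNReal.mul_lt_top (convConst_lt_top hp) (ENNReal.mul_lt_top hf.fin hg.fin))⟩

lemma mul_of_le_one (hf : MemX p f) {e : ℝ × ℝ → ℂ} (he : Measurable e)
    (h1 : ∀ x, ‖e x‖ₑ ≤ 1) : MemX p (fun x => e x * f x) :=
  ⟨he.mul hf.meas, (wnorm_mono fun x => by
    rw [enorm_mul]; exact mul_le_of_le_one_left' (h1 x)).trans_lt hf.fin⟩

end MemX

lemma conv_sub_conv {p : ℝ} (hp : 0 ≤ p) {f g f' g' : ℝ × ℝ → ℂ} (hf : MemX p f)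
    (hg : MemX p g) (hf' : MemX p f') (hg' : MemX p g') :
    conv f g - conv f' g' = conv (f - f') g + conv f' (g - g') := by
  ext ξ
  have i1 := integrable_conv hp hf.meas hg.meas hf.fin hg.fin ξ
  have i2 := integrable_conv hp hf'.meas hg'.meas hf'.fin hg'.fin ξ
  have i3 := integrable_conv hp hf'.meas hg.meas hf'.fin hg.fin ξ
  simp only [conv, Pi.sub_apply, Pi.add_apply, sub_mul, mul_sub]
  rw [integral_sub i1 i3, integral_sub i3 i2]
  ring

lemma wnorm_conv_sub_le {p : ℝ} (hp : 0 ≤ p) {f g f' g' : ℝ × ℝ → ℂ} (hf : MemX p f)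
    (hg : MemX p g) (hf' : MemX p f') (hg' : MemX p g') :
    wnorm p (conv f g - conv f' g') ≤
      convConst p * (wnorm p (f - f') * wnorm p g + wnorm p f' * wnorm p (g - g')) := by
  have m1 := hf.meas.sub hf'.meas
  have m2 := hg.meas.sub hg'.meas
  rw [conv_sub_conv hp hf hg hf' hg', mul_add]
  exact (wnorm_add_le (measurable_conv m1 hg.meas) (measurable_conv hf'.meas m2)).trans
    (add_le_add (wnorm_conv_le hp m1 hg.meas) (wnorm_conv_le hp hf'.meas m2))

lemma enorm_conv_sub_le {p : ℝ} (hp : 0 ≤ p) {f g f' g' : ℝ × ℝ → ℂ} (hf : MemX p f)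
    (hg : MemX p g) (hf' : MemX p f') (hg' : MemX p g') (ξ : ℝ × ℝ) :
    ‖conv f g ξ - conv f' g' ξ‖ₑ ≤
      convConst p * (wnorm p (f - f') * wnorm p g + wnorm p f' * wnorm p (g - g')) := by
  have m1 := hf.meas.sub hf'.meas
  have m2 := hg.meas.sub hg'.meas
  rw [← Pi.sub_apply, conv_sub_conv hp hf hg hf' hg', mul_add]
  exact (enorm_add_le _ _).trans
    (add_le_add (enorm_conv_le hp m1 hg.meas ξ) (enorm_conv_le hp hf'.meas m2 ξ))

/-! ### The nonlinearity -/

/-- The Lipschitz constant of the cubic nonlinearity on the unit ball of `X_p`. -/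
noncomputable def lopConst (p γ lam μ : ℝ) : ℝ≥0∞ :=
  (‖(γ : ℂ)‖ₑ + ‖((lam * μ : ℝ) : ℂ)‖ₑ) * (3 * convConst p ^ 2)

lemma lopConst_lt_top {p : ℝ} (hp : 1 < p) (γ lam μ : ℝ) : lopConst p γ lam μ < ⊤ := by
  have := convConst_lt_top hp
  unfold lopConst
  finiteness

lemma measurable_sigmaMul : Measurable sigmaMul := by
  unfold sigmaMul
  exact Measurable.ite (measurableSet_singleton 0) measurable_const (by fun_prop)

lemma enorm_sigmaMul_le (x : ℝ × ℝ) : ‖(sigmaMul x : ℂ)‖ₑ ≤ 1 := by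
  rw [← ofReal_norm, ENNReal.ofReal_le_one, Complex.norm_real, Real.norm_eq_abs, abs_le,
    sigmaMul]
  split_ifs
  · norm_num
  · have h : 0 ≤ x.1 ^ 2 / (x.1 ^ 2 + x.2 ^ 2) := by positivity
    refine ⟨by linarith, div_le_one_of_le₀ ?_ (by positivity)⟩
    nlinarith [sq_nonneg x.2]

lemma measurable_Lop (γ lam μ : ℝ) {v : ℝ × ℝ → ℂ} (hv : Measurable v) :
    Measurable (Lop γ lam μ v) := by
  have h := measurable_conv hv (measurable_dag hv)
  have h1 := measurable_conv h hv
  have h2 := measurable_conv hv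
    (g := fun η => (sigmaMul η : ℂ) * conv v (dag v) η)
    ((Complex.measurable_ofReal.comp measurable_sigmaMul).mul h)
  unfold Lop
  fun_prop

lemma Lop_sub_bounds {p : ℝ} (hp : 1 < p) (γ lam μ : ℝ) {v w : ℝ × ℝ → ℂ} {M : ℝ≥0∞}
    (hM : M < ⊤) (hv : Measurable v) (hw : Measurable w) (hvM : wnorm p v ≤ M)
    (hwM : wnorm p w ≤ M) :
    wnorm p (Lop γ lam μ v - Lop γ lam μ w) ≤ lopConst p γ lam μ * M ^ 2 * wnorm p (v - w) ∧
    ∀ ξ, ‖Lop γ lam μ v ξ - Lop γ lam μ w ξ‖ₑ ≤ lopConst p γ lam μ * M ^ 2 * wnorm p (v - w) := by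
  have hp0 : 0 ≤ p := by linarith
  have xv : MemX p v := ⟨hv, hvM.trans_lt hM⟩
  have xw : MemX p w := ⟨hw, hwM.trans_lt hM⟩
  set D := wnorm p (v - w) with hD
  set C := convConst p with hC
  have hxv := xv.conv hp xv.dag
  have hxw := xw.conv hp xw.dag
  set h := conv v (dag v) with hh
  set h' := conv w (dag w) with hh'
  have ms : Measurable fun x => (sigmaMul x : ℂ) :=
    Complex.measurable_ofReal.comp measurable_sigmaMul
  have sxv := hxv.mul_of_le_one ms enorm_sigmaMul_le
  have sxw := hxw.mul_of_le_one ms enorm_sigmaMul_le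
  set s := fun x => (sigmaMul x : ℂ) * h x with hs
  set s' := fun x => (sigmaMul x : ℂ) * h' x with hs'
  have bh' : wnorm p h' ≤ C * M ^ 2 := by
    refine (wnorm_conv_le hp0 hw xw.dag.meas).trans ?_
    rw [wnorm_dag, sq]
    gcongr
  have bd : wnorm p (h - h') ≤ C * (2 * M * D) := by
    refine (wnorm_conv_sub_le hp0 xv xv.dag xw xw.dag).trans ?_
    rw [← dag_sub, wnorm_dag, wnorm_dag]
    calc C * (D * wnorm p v + wnorm p w * D) ≤ C * (D * M + M * D) := by gcongr
      _ = _ := by ring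
  have le_s : ∀ f : ℝ × ℝ → ℂ, wnorm p (fun x => (sigmaMul x : ℂ) * f x) ≤ wnorm p f :=
    fun f => wnorm_mono fun x => by
      rw [enorm_mul]; exact mul_le_of_le_one_left' (enorm_sigmaMul_le x)
  have bs' : wnorm p s' ≤ C * M ^ 2 := (le_s h').trans bh'
  have bsd : wnorm p (s - s') ≤ C * (2 * M * D) := by
    refine le_trans (le_of_eq ?_) ((le_s (h - h')).trans bd)
    congr 1; ext x; simp [hs, hs', mul_sub]
  have b1 : C * (wnorm p (h - h') * wnorm p v + wnorm p h' * wnorm p (v - w)) ≤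
      3 * C ^ 2 * (M ^ 2 * D) := by
    calc _ ≤ C * (C * (2 * M * D) * M + C * M ^ 2 * D) := by gcongr
      _ = _ := by ring
  have b2 : C * (wnorm p (v - w) * wnorm p s + wnorm p w * wnorm p (s - s')) ≤
      3 * C ^ 2 * (M ^ 2 * D) := by
    have bs : wnorm p s ≤ C * M ^ 2 := by
      refine (le_s h).trans ((wnorm_conv_le hp0 hv xv.dag.meas).trans ?_)
      rw [wnorm_dag, sq]
      gcongr
    calc _ ≤ C * (D * (C * M ^ 2) + M * (C * (2 * M * D))) := by gcongr
      _ = _ := by ring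
  have e : Lop γ lam μ v - Lop γ lam μ w =
      (fun x => (γ : ℂ) * (conv h v - conv h' w) x) +
        fun x => ((lam * μ : ℝ) : ℂ) * (conv v s - conv w s') x := by
    ext x
    simp only [Lop, Pi.sub_apply, Pi.add_apply, hs, hs', hh, hh']
    ring
  have m1 : Measurable (conv h v - conv h' w) :=
    (measurable_conv hxv.meas hv).sub (measurable_conv hxw.meas hw)
  have m2 : Measurable (conv v s - conv w s') :=
    (measurable_conv hv sxv.meas).sub (measurable_conv hw sxw.meas)
  have fin : ‖(γ : ℂ)‖ₑ * (3 * C ^ 2 * (M ^ 2 * D)) +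
      ‖((lam * μ : ℝ) : ℂ)‖ₑ * (3 * C ^ 2 * (M ^ 2 * D)) =
      lopConst p γ lam μ * M ^ 2 * D := by
    rw [lopConst, ← hC]; ring
  refine ⟨?_, fun ξ => ?_⟩
  · rw [e, ← fin]
    refine (wnorm_add_le (m1.const_mul _) (m2.const_mul _)).trans ?_
    rw [wnorm_const_mul, wnorm_const_mul]
    gcongr
    · exact (wnorm_conv_sub_le hp0 hxv xv hxw xw).trans b1
    · exact (wnorm_conv_sub_le hp0 xv sxv xw sxw).trans b2
  · rw [← Pi.sub_apply, e, ← fin]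
    refine (enorm_add_le _ _).trans ?_
    rw [enorm_mul, enorm_mul]
    gcongr
    · exact (enorm_conv_sub_le hp0 hxv xv hxw xw ξ).trans b1
    · exact (enorm_conv_sub_le hp0 xv sxv xw sxw ξ).trans b2

lemma Lop_zero (γ lam μ : ℝ) : Lop γ lam μ 0 = 0 := by
  ext x; simp [Lop, conv]

lemma wnorm_Lop_le {p : ℝ} (hp : 1 < p) (γ lam μ : ℝ) {v : ℝ × ℝ → ℂ} {M : ℝ≥0∞}
    (hM : M < ⊤) (hv : Measurable v) (hvM : wnorm p v ≤ M) :
    wnorm p (Lop γ lam μ v) ≤ lopConst p γ lam μ * M ^ 3 := by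
  have h := (Lop_sub_bounds hp γ lam μ hM hv (w := 0) measurable_const hvM
    (by simp [wnorm_zero])).1
  rw [Lop_zero, sub_zero, sub_zero] at h
  calc _ ≤ lopConst p γ lam μ * M ^ 2 * wnorm p v := h
    _ ≤ lopConst p γ lam μ * M ^ 2 * M := by gcongr
    _ = _ := by ring

/-! ### The free phase -/

/-- The phase `e^{i(k² - m²)t}`. -/
noncomputable def phase (t : ℝ) (x : ℝ × ℝ) : ℂ :=
  Complex.exp (Complex.I * (((x.1 ^ 2 - x.2 ^ 2) * t : ℝ) : ℂ))

lemma enorm_phase (t : ℝ) (x : ℝ × ℝ) : ‖phase t x‖ₑ = 1 := by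
  rw [phase, mul_comm, ← ofReal_norm, Complex.norm_exp_ofReal_mul_I, ENNReal.ofReal_one]

lemma measurable_phase (t : ℝ) : Measurable (phase t) := by
  unfold phase; fun_prop

lemma continuous_phase (x : ℝ × ℝ) : Continuous fun t => phase t x := by
  unfold phase; fun_prop

lemma phase_add (s t : ℝ) (x : ℝ × ℝ) : phase (s + t) x = phase s x * phase t x := by
  rw [phase, phase, phase, ← Complex.exp_add]
  congr 1; push_cast; ring

lemma phase2_eq (t : ℝ) (x : ℝ × ℝ) : phase2 t x = phase (2 * t) x := by
  rw [phase, phase2]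
  congr 1; push_cast; ring

lemma tendsto_wnorm_phase_sub_mul {p : ℝ} {f : ℝ × ℝ → ℂ} (hf : MemX p f) (c t₀ : ℝ) :
    Tendsto (fun t => wnorm p (fun x => (phase (c * t) x - phase (c * t₀) x) * f x))
      (𝓝 t₀) (𝓝 0) := by
  have hw := measurable_wt p
  have hfm := hf.meas
  have hm := measurable_phase
  have hz : (0 : ℝ≥0∞) = (∫⁻ _ : ℝ × ℝ, 0) ^ (1 / 2 : ℝ) := by simp
  simp only [wnorm_eq_wmass]
  rw [hz]
  refine (ENNReal.continuous_rpow_const.tendsto _).comp ?_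
  unfold wmass
  refine tendsto_lintegral_filter_of_dominated_convergence
    (fun x => 4 * (wt p x * ‖f x‖ₑ) ^ 2) ?_ ?_ ?_ ?_
  · refine Eventually.of_forall fun t => ?_
    have h1 := hm (c * t)
    have h2 := hm (c * t₀)
    fun_prop
  · refine Eventually.of_forall fun t => Eventually.of_forall fun x => ?_
    have h2 : ‖phase (c * t) x - phase (c * t₀) x‖ₑ ≤ 2 := by
      refine enorm_sub_le.trans ?_
      rw [enorm_phase, enorm_phase, one_add_one_eq_two]
    calc (wt p x * ‖(phase (c * t) x - phase (c * t₀) x) * f x‖ₑ) ^ 2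
        ≤ (wt p x * (2 * ‖f x‖ₑ)) ^ 2 := by
          rw [enorm_mul]; gcongr
      _ = 4 * (wt p x * ‖f x‖ₑ) ^ 2 := by ring
  · rw [lintegral_const_mul _ (by fun_prop)]
    refine ENNReal.mul_ne_top (by norm_num) fun h => ?_
    have h3 := hf.fin
    rw [wnorm_eq_wmass, wmass, h] at h3
    simp at h3
  · refine Eventually.of_forall fun x => ?_
    have h1 : Continuous fun t => (wt p x * ‖(phase (c * t) x - phase (c * t₀) x) * f x‖ₑ) ^ 2 := by
      have h2 : Continuous fun t => ‖(phase (c * t) x - phase (c * t₀) x) * f x‖ₑ := by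
        have := (continuous_phase x).comp (continuous_const_mul c)
        exact ((this.sub continuous_const).mul continuous_const).enorm
      exact (ENNReal.continuous_pow 2).comp
        ((ENNReal.continuous_const_mul ENNReal.ofReal_ne_top).comp h2)
    simpa using h1.tendsto t₀

/-! ### Integrals of curves -/

lemma measurable_intervalIntegral {g : ℝ → ℝ × ℝ → ℂ} (hg : Measurable (Function.uncurry g))
    (s t : ℝ) : Measurable fun ξ => ∫ τ in s..t, g τ ξ := by
  have h : ∀ a b : ℝ, Measurable fun ξ => ∫ τ in Set.Ioc a b, g τ ξ := fun a b =>
    (StronglyMeasurable.integral_prod_left' (μ := volume.restrict (Set.Ioc a b))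
      hg.stronglyMeasurable).measurable
  exact (h s t).sub (h t s)

lemma wnorm_intervalIntegral_le {p : ℝ} {g : ℝ → ℝ × ℝ → ℂ}
    (hg : Measurable (Function.uncurry g)) {B : ℝ≥0∞} (hB : ∀ τ, wnorm p (g τ) ≤ B) (s t : ℝ) :
    wnorm p (fun ξ => ∫ τ in s..t, g τ ξ) ≤ ENNReal.ofReal |t - s| * B := by
  have hw := measurable_wt p
  have hS : ∀ τ, wmass p (fun x => ‖g τ x‖ₑ) ≤ B ^ 2 := fun τ => by
    have h := hB τ
    rwa [wnorm_eq_wmass, one_div, ENNReal.rpow_inv_le_iff (by norm_num), ENNReal.rpow_two] at h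
  set ν := volume.restrict (Set.uIoc s t) with hν
  have hmass : ν Set.univ = ENNReal.ofReal |t - s| := by
    rw [hν, Measure.restrict_apply_univ, Real.volume_uIoc]
  have hgm : ∀ ξ, Measurable fun τ => g τ ξ := fun ξ =>
    hg.comp (measurable_id.prodMk measurable_const)
  have hgw : Measurable fun z : (ℝ × ℝ) × ℝ => (wt p z.1 * ‖g z.2 z.1‖ₑ) ^ 2 := by
    have h : Measurable fun z : (ℝ × ℝ) × ℝ => g z.2 z.1 := hg.comp measurable_swap
    fun_prop
  have hpt : ∀ ξ, ‖∫ τ in s..t, g τ ξ‖ₑ ^ 2 ≤ ν Set.univ * ∫⁻ τ, ‖g τ ξ‖ₑ ^ 2 ∂ν := by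
    intro ξ
    have h0 : ‖∫ τ in s..t, g τ ξ‖ₑ ≤ ∫⁻ τ, 1 * ‖g τ ξ‖ₑ ∂ν := by
      rw [← ofReal_norm, intervalIntegral.norm_integral_eq_norm_integral_uIoc, ofReal_norm]
      simpa using enorm_integral_le_lintegral_enorm _
    refine (pow_le_pow_left' h0 2).trans ?_
    have := hgm ξ
    refine (lintegral_mul_sq_le_lintegral_mul (by fun_prop) (by fun_prop)).trans_eq ?_
    simp
  rw [wnorm_eq_wmass, one_div, ENNReal.rpow_inv_le_iff (by norm_num), ENNReal.rpow_two]
  calc wmass p (fun ξ => ‖∫ τ in s..t, g τ ξ‖ₑ)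
      ≤ ∫⁻ ξ, ν Set.univ * ∫⁻ τ, (wt p ξ * ‖g τ ξ‖ₑ) ^ 2 ∂ν := by
        refine lintegral_mono fun ξ => ?_
        simp only [mul_pow]
        have := hgm ξ
        rw [lintegral_const_mul _ (by fun_prop), mul_left_comm]
        gcongr
        exact hpt ξ
    _ = ν Set.univ * ∫⁻ ξ, ∫⁻ τ, (wt p ξ * ‖g τ ξ‖ₑ) ^ 2 ∂ν :=
        lintegral_const_mul _ hgw.lintegral_prod_right'
    _ = ν Set.univ * ∫⁻ τ, wmass p (fun x => ‖g τ x‖ₑ) ∂ν := by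
        rw [lintegral_lintegral_swap hgw.aemeasurable]
        rfl
    _ ≤ ν Set.univ * ∫⁻ _, B ^ 2 ∂ν := by
        gcongr with τ
        exact hS τ
    _ = (ENNReal.ofReal |t - s| * B) ^ 2 := by
        rw [lintegral_const, hmass]; ring

/-- A curve `ℝ → X_p`, continuous for the weighted norm and bounded by `M`. -/
structure IsBddCurve (p : ℝ) (M : ℝ≥0∞) (v : ℝ → ℝ × ℝ → ℂ) : Prop where
  meas : ∀ τ, Measurable (v τ)
  cont : ∀ τ₀, Tendsto (fun τ => wnorm p (v τ - v τ₀)) (𝓝 τ₀) (𝓝 0)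
  bdd : ∀ τ, wnorm p (v τ) ≤ M

lemma IsBddCurve.mul_phase2 {p : ℝ} {M : ℝ≥0∞} {v : ℝ → ℝ × ℝ → ℂ} (hv : IsBddCurve p M v)
    (hM : M < ⊤) : IsBddCurve p M (fun τ x => v τ x * phase2 τ x) := by
  have hm : ∀ τ, Measurable (phase2 τ) := fun τ => by
    simp only [funext (phase2_eq τ), measurable_phase]
  have he : ∀ τ x, ‖phase2 τ x‖ₑ = 1 := fun τ x => by rw [phase2_eq, enorm_phase]
  refine ⟨fun τ => (hv.meas τ).mul (hm τ), fun τ₀ => ?_, fun τ => ?_⟩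
  · have h1 := tendsto_wnorm_phase_sub_mul
      (⟨hv.meas τ₀, (hv.bdd τ₀).trans_lt hM⟩ : MemX p (v τ₀)) 2 τ₀
    have h2 := (hv.cont τ₀).add h1
    rw [add_zero] at h2
    refine tendsto_of_tendsto_of_tendsto_of_le_of_le tendsto_const_nhds h2
      (fun _ => zero_le) fun τ => ?_
    have e : (fun x => v τ x * phase2 τ x) - (fun x => v τ₀ x * phase2 τ₀ x) =
        (fun x => (v τ - v τ₀) x * phase2 τ x) +
          fun x => (phase (2 * τ) x - phase (2 * τ₀) x) * v τ₀ x := by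
      ext x
      simp only [Pi.sub_apply, Pi.add_apply, phase2_eq]
      ring
    simp only [e]
    refine (wnorm_add_le (((hv.meas τ).sub (hv.meas τ₀)).mul (hm τ))
      (((measurable_phase _).sub (measurable_phase _)).mul (hv.meas τ₀))).trans ?_
    exact add_le_add (wnorm_mono fun x => by simp [enorm_mul, he]) le_rfl
  · exact (wnorm_mono fun x => by simp [enorm_mul, he]).trans (hv.bdd τ)

/-- The integrand of the Duhamel operator, with the outer free phase factored out. -/
noncomputable def duhamelIntegrand (γ lam μ : ℝ) (v : ℝ → ℝ × ℝ → ℂ) (τ : ℝ) (x : ℝ × ℝ) : ℂ :=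
  phase τ x * Lop γ lam μ (fun y => v τ y * phase2 τ y) x

lemma duhamel_eq (γ lam μ : ℝ) (u0 : ℝ × ℝ → ℂ) (v : ℝ → ℝ × ℝ → ℂ) (t : ℝ) (x : ℝ × ℝ) :
    duhamel γ lam μ u0 v t x =
      phase (-t) x * (u0 x - Complex.I * ∫ τ in (0 : ℝ)..t, duhamelIntegrand γ lam μ v τ x) := by
  have h : ∀ τ, Complex.exp (Complex.I * (((x.1 ^ 2 - x.2 ^ 2) * (τ - t) : ℝ) : ℂ)) =
      phase (-t) x * phase τ x := fun τ => by
    rw [← phase_add, phase]; congr 1; push_cast; ring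
  have h0 : Complex.exp (Complex.I * (((x.2 ^ 2 - x.1 ^ 2) * t : ℝ) : ℂ)) = phase (-t) x := by
    rw [phase]; congr 1; push_cast; ring
  simp only [duhamel, h, h0, mul_assoc, duhamelIntegrand]
  rw [intervalIntegral.integral_const_mul]
  ring

namespace IsBddCurve

variable {p : ℝ} {M : ℝ≥0∞} {v w : ℝ → ℝ × ℝ → ℂ}

lemma continuous_integrand (hp : 1 < p) (γ lam μ : ℝ) (hM : M < ⊤) (hv : IsBddCurve p M v)
    (x : ℝ × ℝ) : Continuous fun τ => duhamelIntegrand γ lam μ v τ x := by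
  refine (continuous_phase x).mul (continuous_iff_continuousAt.2 fun τ₀ => ?_)
  have hu := hv.mul_phase2 hM
  have hK : lopConst p γ lam μ * M ^ 2 ≠ ⊤ := by
    have := lopConst_lt_top hp γ lam μ
    finiteness
  have h := ENNReal.Tendsto.const_mul (hu.cont τ₀) (Or.inr hK)
  rw [mul_zero] at h
  rw [ContinuousAt, tendsto_iff_edist_tendsto_0]
  refine tendsto_of_tendsto_of_tendsto_of_le_of_le tendsto_const_nhds h
    (fun _ => zero_le) fun τ => ?_
  rw [edist_eq_enorm_sub]
  exact (Lop_sub_bounds hp γ lam μ hM (hu.meas τ) (hu.meas τ₀) (hu.bdd τ) (hu.bdd τ₀)).2 x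

lemma measurable_integrand (hp : 1 < p) (γ lam μ : ℝ) (hM : M < ⊤) (hv : IsBddCurve p M v) :
    Measurable (Function.uncurry (duhamelIntegrand γ lam μ v)) :=
  measurable_uncurry_of_continuous_of_measurable (hv.continuous_integrand hp γ lam μ hM)
    fun τ => (measurable_phase τ).mul (measurable_Lop γ lam μ ((hv.mul_phase2 hM).meas τ))

lemma wnorm_integrand_le (hp : 1 < p) (γ lam μ : ℝ) (hM : M < ⊤) (hv : IsBddCurve p M v)
    (τ : ℝ) : wnorm p (duhamelIntegrand γ lam μ v τ) ≤ lopConst p γ lam μ * M ^ 3 := by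
  have hu := hv.mul_phase2 hM
  refine (wnorm_congr fun x => ?_).trans_le
    (wnorm_Lop_le hp γ lam μ hM (hu.meas τ) (hu.bdd τ))
  rw [duhamelIntegrand, enorm_mul, enorm_phase, one_mul]

lemma wnorm_integrand_sub_le (hp : 1 < p) (γ lam μ : ℝ) (hM : M < ⊤) (hv : IsBddCurve p M v)
    (hw : IsBddCurve p M w) (τ : ℝ) :
    wnorm p (duhamelIntegrand γ lam μ v τ - duhamelIntegrand γ lam μ w τ) ≤
      lopConst p γ lam μ * M ^ 2 * wnorm p (v τ - w τ) := by
  have hu := hv.mul_phase2 hM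
  have hu' := hw.mul_phase2 hM
  refine (wnorm_congr fun x => ?_).trans_le ((Lop_sub_bounds hp γ lam μ hM (hu.meas τ)
    (hu'.meas τ) (hu.bdd τ) (hu'.bdd τ)).1.trans_eq ?_)
  · rw [Pi.sub_apply, duhamelIntegrand, duhamelIntegrand, ← mul_sub, enorm_mul, enorm_phase,
      one_mul, Pi.sub_apply]
  · congr 1
    exact wnorm_congr fun x => by
      simp [← sub_mul, enorm_mul, phase2_eq, enorm_phase]

lemma measurable_duhamel (hp : 1 < p) (γ lam μ : ℝ) {u0 : ℝ × ℝ → ℂ} (hu0 : Measurable u0)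
    (hM : M < ⊤) (hv : IsBddCurve p M v) (t : ℝ) : Measurable (duhamel γ lam μ u0 v t) := by
  rw [funext (duhamel_eq γ lam μ u0 v t)]
  exact (measurable_phase _).mul (hu0.sub ((measurable_intervalIntegral
    (hv.measurable_integrand hp γ lam μ hM) 0 t).const_mul _))

lemma wnorm_duhamel_le (hp : 1 < p) (γ lam μ : ℝ) {u0 : ℝ × ℝ → ℂ} (hu0 : Measurable u0)
    (hM : M < ⊤) (hv : IsBddCurve p M v) (t : ℝ) :
    wnorm p (duhamel γ lam μ u0 v t) ≤
      wnorm p u0 + ENNReal.ofReal |t| * (lopConst p γ lam μ * M ^ 3) := by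
  have hI := hv.measurable_integrand hp γ lam μ hM
  have e : wnorm p (duhamel γ lam μ u0 v t) = wnorm p (u0 - fun x =>
      Complex.I * ∫ τ in (0 : ℝ)..t, duhamelIntegrand γ lam μ v τ x) :=
    wnorm_congr fun x => by
      rw [duhamel_eq, enorm_mul, enorm_phase, one_mul, Pi.sub_apply]
  rw [e]
  refine (wnorm_sub_le hu0 ((measurable_intervalIntegral hI 0 t).const_mul _)).trans ?_
  gcongr
  rw [wnorm_const_mul]
  simpa [← ofReal_norm] using
    wnorm_intervalIntegral_le hI (hv.wnorm_integrand_le hp γ lam μ hM) 0 t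

lemma wnorm_duhamel_sub_le (hp : 1 < p) (γ lam μ : ℝ) (u0 : ℝ × ℝ → ℂ) (hM : M < ⊤)
    (hv : IsBddCurve p M v) (hw : IsBddCurve p M w) {D : ℝ≥0∞}
    (hD : ∀ τ, wnorm p (v τ - w τ) ≤ D) (t : ℝ) :
    wnorm p (duhamel γ lam μ u0 v t - duhamel γ lam μ u0 w t) ≤
      ENNReal.ofReal |t| * (lopConst p γ lam μ * M ^ 2 * D) := by
  have e : wnorm p (duhamel γ lam μ u0 v t - duhamel γ lam μ u0 w t) = wnorm p fun x =>
      ∫ τ in (0 : ℝ)..t, (duhamelIntegrand γ lam μ v τ - duhamelIntegrand γ lam μ w τ) x :=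
    wnorm_congr fun x => by
      simp only [Pi.sub_apply]
      rw [intervalIntegral.integral_sub
        ((hv.continuous_integrand hp γ lam μ hM x).intervalIntegrable _ _)
        ((hw.continuous_integrand hp γ lam μ hM x).intervalIntegrable _ _),
        duhamel_eq, duhamel_eq, ← mul_sub, enorm_mul, enorm_phase, one_mul,
        sub_sub_sub_cancel_left, ← mul_sub, enorm_mul, enorm_sub_rev]
      simp [← ofReal_norm]
  rw [e]
  have h := wnorm_intervalIntegral_le
    (g := fun τ => duhamelIntegrand γ lam μ v τ - duhamelIntegrand γ lam μ w τ)
    ((hv.measurable_integrand hp γ lam μ hM).sub (hw.measurable_integrand hp γ lam μ hM))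
    (fun τ => (hv.wnorm_integrand_sub_le hp γ lam μ hM hw τ).trans
      (mul_le_mul_right (hD τ) _)) 0 t
  rwa [sub_zero] at h

lemma tendsto_wnorm_duhamel_sub (hp : 1 < p) (γ lam μ : ℝ) {u0 : ℝ × ℝ → ℂ} (hu0 : MemX p u0)
    (hM : M < ⊤) (hv : IsBddCurve p M v) (t₀ : ℝ) :
    Tendsto (fun t => wnorm p (duhamel γ lam μ u0 v t - duhamel γ lam μ u0 v t₀))
      (𝓝 t₀) (𝓝 0) := by
  have hI := hv.measurable_integrand hp γ lam μ hM
  have hK : lopConst p γ lam μ * M ^ 3 ≠ ⊤ := by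
    have := lopConst_lt_top hp γ lam μ
    finiteness
  have hA := hv.measurable_duhamel hp γ lam μ hu0.meas hM t₀
  have hfin : MemX p fun x => phase t₀ x * duhamel γ lam μ u0 v t₀ x := by
    refine MemX.mul_of_le_one ⟨hA, ?_⟩ (measurable_phase _) fun x => (enorm_phase t₀ x).le
    refine (hv.wnorm_duhamel_le hp γ lam μ hu0.meas hM t₀).trans_lt ?_
    have := hu0.fin
    finiteness
  have h1 := tendsto_wnorm_phase_sub_mul hfin (-1) t₀
  have h2 : Tendsto (fun t => ENNReal.ofReal |t - t₀| * (lopConst p γ lam μ * M ^ 3))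
      (𝓝 t₀) (𝓝 0) := by
    have h3 : Continuous fun t : ℝ => ENNReal.ofReal |t - t₀| :=
      ENNReal.continuous_ofReal.comp (by fun_prop)
    have h4 := ENNReal.Tendsto.mul_const (h3.tendsto t₀) (Or.inr hK)
    simpa using h4
  have h := h1.add h2
  rw [add_zero] at h
  refine tendsto_of_tendsto_of_tendsto_of_le_of_le tendsto_const_nhds h
    (fun _ => zero_le) fun t => ?_
  have e : duhamel γ lam μ u0 v t - duhamel γ lam μ u0 v t₀ =
      (fun x => (phase (-1 * t) x - phase (-1 * t₀) x) *
        (phase t₀ x * duhamel γ lam μ u0 v t₀ x)) +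
      fun x => (-Complex.I * phase (-t) x) *
        ∫ τ in t₀..t, duhamelIntegrand γ lam μ v τ x := by
    ext x
    have hc := hv.continuous_integrand hp γ lam μ hM x
    have hs := intervalIntegral.integral_add_adjacent_intervals
      (hc.intervalIntegrable 0 t₀) (hc.intervalIntegrable t₀ t) (μ := volume)
    have hph : phase t₀ x * phase (-t₀) x = 1 := by
      rw [← phase_add]; simp [phase]
    simp only [Pi.sub_apply, Pi.add_apply, duhamel_eq, neg_mul, one_mul, ← hs]
    linear_combination (phase (-t₀) x - phase (-t) x) *
      (u0 x - Complex.I * ∫ τ in (0 : ℝ)..t₀, duhamelIntegrand γ lam μ v τ x) * hph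
  simp only [e]
  refine (wnorm_add_le (((measurable_phase _).sub (measurable_phase _)).mul hfin.meas)
    (((measurable_phase _).const_mul _).mul (measurable_intervalIntegral hI t₀ t))).trans ?_
  refine add_le_add le_rfl (le_trans (wnorm_mono fun x => le_of_eq ?_)
    (wnorm_intervalIntegral_le hI (hv.wnorm_integrand_le hp γ lam μ hM) t₀ t))
  rw [Pi.mul_apply, enorm_mul, enorm_mul, enorm_phase]
  simp [← ofReal_norm]

end IsBddCurve

lemma ContCurve.isBddCurve_comp_projIcc {p T : ℝ} (hT : 0 ≤ T) {M : ℝ≥0∞}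
    {v : ℝ → ℝ × ℝ → ℂ} (hv : ContCurve p T v)
    (hM : (⨆ t ∈ Set.Icc (0 : ℝ) T, wnorm p (v t)) ≤ M) :
    IsBddCurve p M fun t => v (Set.projIcc 0 T hT t) := by
  refine ⟨fun τ => hv.1 _ (Subtype.coe_prop _), fun τ₀ => ?_, fun τ =>
    (le_iSup₂_of_le _ (Subtype.coe_prop _) le_rfl).trans hM⟩
  refine (hv.2 _ (Set.projIcc 0 T hT τ₀).2).comp (tendsto_nhdsWithin_iff.2 ⟨?_, ?_⟩)
  · exact (continuous_subtype_val.comp continuous_projIcc).tendsto τ₀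
  · exact Eventually.of_forall fun τ => Subtype.coe_prop _

lemma duhamel_comp_projIcc {T : ℝ} (hT : 0 ≤ T) (γ lam μ : ℝ) (u0 : ℝ × ℝ → ℂ)
    (v : ℝ → ℝ × ℝ → ℂ) {t : ℝ} (ht : t ∈ Set.Icc (0 : ℝ) T) :
    duhamel γ lam μ u0 (fun t => v (Set.projIcc 0 T hT t)) t = duhamel γ lam μ u0 v t := by
  ext x
  rw [duhamel_eq, duhamel_eq]
  congr 3
  refine intervalIntegral.integral_congr fun τ hτ => ?_
  rw [Set.uIcc_of_le ht.1] at hτ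
  simp only [duhamelIntegrand]
  rw [Set.projIcc_of_mem hT ⟨hτ.1, hτ.2.trans ht.2⟩]

/-- **The Duhamel operator is a contraction of the ball `B = {‖v‖ ≤ 2R}`.** For `p > 1`
and `û₀` measurable with `0 < ‖û₀‖_p = R < ∞`, there is `T > 0` such that `A` maps the
closed ball `B ⊆ C([0,T]; X_p)` of radius `2R` into itself and is a `1/2`-contraction
on `B` for the sup-norm. -/
theorem duhamel_contraction (p : ℝ) (hp : 1 < p) (γ lam μ : ℝ)
    (u0 : ℝ × ℝ → ℂ) (hu0 : Measurable u0) (R : ℝ≥0∞)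
    (hR : wnorm p u0 = R) (hRpos : 0 < R) (hRfin : R < ⊤) :
    ∃ T : ℝ, 0 < T ∧
      (∀ v : ℝ → ℝ × ℝ → ℂ, ContCurve p T v →
        (⨆ t ∈ Set.Icc (0 : ℝ) T, wnorm p (v t)) ≤ 2 * R →
        ContCurve p T (duhamel γ lam μ u0 v) ∧
        (⨆ t ∈ Set.Icc (0 : ℝ) T, wnorm p (duhamel γ lam μ u0 v t)) ≤ 2 * R) ∧
      (∀ v w : ℝ → ℝ × ℝ → ℂ, ContCurve p T v → ContCurve p T w →
        (⨆ t ∈ Set.Icc (0 : ℝ) T, wnorm p (v t)) ≤ 2 * R →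
        (⨆ t ∈ Set.Icc (0 : ℝ) T, wnorm p (w t)) ≤ 2 * R →
        (⨆ t ∈ Set.Icc (0 : ℝ) T,
            wnorm p (duhamel γ lam μ u0 v t - duhamel γ lam μ u0 w t)) ≤
          (1 / 2 : ℝ≥0∞) * ⨆ t ∈ Set.Icc (0 : ℝ) T, wnorm p (v t - w t)) := by
  have hp0 : 0 ≤ p := by linarith
  have xu0 : MemX p u0 := ⟨hu0, hR.trans_lt hRfin⟩
  have hM : 2 * R < ⊤ := by finiteness
  set K := lopConst p γ lam μ with hK
  have hKfin : 2 * (K * (2 * R) ^ 2) ≠ ⊤ := by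
    have := lopConst_lt_top hp γ lam μ
    finiteness
  set c := (2 * (K * (2 * R) ^ 2)).toReal with hc
  have hc0 : 0 ≤ c := ENNReal.toReal_nonneg
  refine ⟨(1 + c)⁻¹, by positivity, ?_⟩
  set T := (1 + c)⁻¹ with hTdef
  have hT : 0 ≤ T := by positivity
  have small : ∀ {t}, t ∈ Set.Icc 0 T → ENNReal.ofReal |t| * (K * (2 * R) ^ 2) ≤ 1 / 2 := by
    intro t ht
    rw [ENNReal.le_div_iff_mul_le (by norm_num) (by norm_num), mul_assoc, mul_comm _ 2,
      ← ENNReal.ofReal_toReal hKfin, ← hc, abs_of_nonneg ht.1, ← ENNReal.ofReal_mul ht.1,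
      ENNReal.ofReal_le_one]
    calc t * c ≤ T * (1 + c) := mul_le_mul ht.2 (by linarith) hc0 hT
      _ = 1 := inv_mul_cancel₀ (by positivity)
  refine ⟨fun v hv hvM => ?_, fun v w hv hw hvM hwM => ?_⟩
  · have bv := hv.isBddCurve_comp_projIcc hT hvM
    refine ⟨⟨fun t ht => ?_, fun t₀ ht₀ => ?_⟩, iSup₂_le fun t ht => ?_⟩
    · rw [← duhamel_comp_projIcc hT γ lam μ u0 v ht]
      exact bv.measurable_duhamel hp γ lam μ hu0 hM t
    · refine ((bv.tendsto_wnorm_duhamel_sub hp γ lam μ xu0 hM t₀).mono_left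
        nhdsWithin_le_nhds).congr' ?_
      filter_upwards [self_mem_nhdsWithin] with t ht
      rw [duhamel_comp_projIcc hT γ lam μ u0 v ht, duhamel_comp_projIcc hT γ lam μ u0 v ht₀]
    · rw [← duhamel_comp_projIcc hT γ lam μ u0 v ht]
      refine (bv.wnorm_duhamel_le hp γ lam μ hu0 hM t).trans ?_
      calc wnorm p u0 + ENNReal.ofReal |t| * (K * (2 * R) ^ 3)
          = R + ENNReal.ofReal |t| * (K * (2 * R) ^ 2) * (2 * R) := by rw [hR]; ring
        _ ≤ R + 1 / 2 * (2 * R) := by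
            gcongr
            exact small ht
        _ = 2 * R := by
            rw [← mul_assoc, one_div, ENNReal.inv_mul_cancel (by norm_num) (by norm_num),
              one_mul, two_mul]
  · have bv := hv.isBddCurve_comp_projIcc hT hvM
    have bw := hw.isBddCurve_comp_projIcc hT hwM
    refine iSup₂_le fun t ht => ?_
    rw [← duhamel_comp_projIcc hT γ lam μ u0 v ht, ← duhamel_comp_projIcc hT γ lam μ u0 w ht]
    refine (bv.wnorm_duhamel_sub_le hp γ lam μ u0 hM bw
      (D := ⨆ t ∈ Set.Icc (0 : ℝ) T, wnorm p (v t - w t))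
      (fun τ => le_iSup₂_of_le _ (Subtype.coe_prop _) le_rfl) t).trans ?_
    rw [← mul_assoc]
    gcongr
    exact small ht
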